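/- arXiv:1510.00318 — 7 statements merged into one kernel-verified Lean document; each statement's English description precedes it below -/
import Mathlib

section
/- For every natural number n, the Fibonacci quaternion F_n is a zero divisor in H[Z_2] (equivalently, F_n is not a unit) if and only if n ≡ 0 (mod 3). -/
open Quaternion

/-- The n-th Fibonacci quaternion over a commutative ring `R`:
`F_n = f_n + f_{n+1}·i + f_{n+2}·j + f_{n+3}·k` in `ℍ[R] = H(-1,-1)`. -/
def fibQuat (R : Type*) [CommRing R] (n : ℕ) : ℍ[R] :=
  ⟨(Nat.fib n : R), (Nat.fib (n + 1) : R), (Nat.fib (n + 2) : R), (Nat.fib (n + 3) : R)⟩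

/-- A quaternion over a commutative ring is a unit iff its norm is. -/
theorem Quaternion.isUnit_iff_isUnit_normSq {R : Type*} [CommRing R] (q : ℍ[R]) :
    IsUnit q ↔ IsUnit (normSq q) := by
  refine ⟨fun h => h.map normSq, fun h => ?_⟩
  have hu : IsUnit ((normSq q : R) : ℍ[R]) := h.map (algebraMap R ℍ[R])
  have hc : Commute q (star q) := by
    rw [Commute, SemiconjBy, self_mul_star, star_mul_self]
  rw [← self_mul_star, hc.isUnit_mul_iff] at hu
  exact hu.1

theorem Nat.two_dvd_fib_iff (m : ℕ) : 2 ∣ Nat.fib m ↔ 3 ∣ m := by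
  refine ⟨fun h => ?_, fun h => Nat.fib_dvd 3 m h⟩
  have hg : Nat.fib (Nat.gcd 3 m) = 2 := by
    rw [Nat.fib_gcd]
    exact Nat.gcd_eq_left h
  rcases (Nat.dvd_prime Nat.prime_three).1 (Nat.gcd_dvd_left 3 m) with h1 | h3
  · simp [h1] at hg
  · exact Nat.gcd_eq_left_iff_dvd.1 h3

theorem normSq_fibQuat_mod_two (n : ℕ) :
    normSq (fibQuat (ZMod 2) n) = (Nat.fib (n + 3) : ZMod 2) := by
  have h2 : Nat.fib (n + 2) = Nat.fib n + Nat.fib (n + 1) := Nat.fib_add_two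
  have h3 : Nat.fib (n + 3) = Nat.fib (n + 1) + Nat.fib (n + 2) := Nat.fib_add_two
  simp only [fibQuat, h3, h2, Nat.cast_add]
  generalize (Nat.fib n : ZMod 2) = a
  generalize (Nat.fib (n + 1) : ZMod 2) = b
  revert a b
  decide

theorem fibQuat_zeroDivisor_iff_mod_two (n : ℕ) :
    ¬ IsUnit (fibQuat (ZMod 2) n) ↔ n % 3 = 0 := by
  rw [Quaternion.isUnit_iff_isUnit_normSq, normSq_fibQuat_mod_two, isUnit_iff_ne_zero, not_not,
    ZMod.natCast_eq_zero_iff, Nat.two_dvd_fib_iff]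
  omega
end

section
/- In H[Z_2], the set {F_n : n ∈ ℕ} of Fibonacci quaternions contains exactly one zero divisor, namely i + j, and exactly two units, namely 1 + i + k and 1 + j + k. -/
open Quaternion

theorem Nat.cast_fib_add_three_of_charTwo (R : Type*) [CommRing R] [CharP R 2] (n : ℕ) :
    (Nat.fib (n + 3) : R) = Nat.fib n := by
  rw [Nat.fib_add_two, Nat.fib_add_two]
  push_cast
  linear_combination (Nat.fib (n + 1) : R) * CharTwo.two_eq_zero (R := R)

theorem fibQuat_periodic_three (R : Type*) [CommRing R] [CharP R 2] :
    Function.Periodic (fibQuat R) 3 := fun n => by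
  ext
  · exact Nat.cast_fib_add_three_of_charTwo R n
  · exact Nat.cast_fib_add_three_of_charTwo R (n + 1)
  · exact Nat.cast_fib_add_three_of_charTwo R (n + 2)
  · exact Nat.cast_fib_add_three_of_charTwo R (n + 3)

theorem exists_eq_fibQuat_zmod_two_iff {x : ℍ[ZMod 2]} :
    (∃ n, x = fibQuat (ZMod 2) n) ↔
      x = ⟨0, 1, 1, 0⟩ ∨ x = ⟨1, 1, 0, 1⟩ ∨ x = ⟨1, 0, 1, 1⟩ := by
  have h0 : fibQuat (ZMod 2) 0 = ⟨0, 1, 1, 0⟩ := by ext <;> decide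
  have h1 : fibQuat (ZMod 2) 1 = ⟨1, 1, 0, 1⟩ := by ext <;> decide
  have h2 : fibQuat (ZMod 2) 2 = ⟨1, 0, 1, 1⟩ := by ext <;> decide
  constructor
  · rintro ⟨n, rfl⟩
    rw [← (fibQuat_periodic_three (ZMod 2)).map_mod_nat n]
    have hn : n % 3 < 3 := Nat.mod_lt n (by norm_num)
    interval_cases n % 3
    exacts [Or.inl h0, Or.inr (Or.inl h1), Or.inr (Or.inr h2)]
  · rintro (rfl | rfl | rfl)
    exacts [⟨0, h0.symm⟩, ⟨1, h1.symm⟩, ⟨2, h2.symm⟩]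

theorem not_isUnit_i_add_j : ¬ IsUnit (⟨0, 1, 1, 0⟩ : ℍ[ZMod 2]) := fun h => by
  have hsq : (⟨0, 1, 1, 0⟩ : ℍ[ZMod 2]) * ⟨0, 1, 1, 0⟩ = 0 := by (ext <;> simp); decide
  have hzero := congrArg QuaternionAlgebra.imI (h.mul_left_eq_zero.mp hsq)
  exact absurd hzero (by simp)

theorem isUnit_one_add_i_add_k : IsUnit (⟨1, 1, 0, 1⟩ : ℍ[ZMod 2]) := by
  have hsq : (⟨1, 1, 0, 1⟩ : ℍ[ZMod 2]) * ⟨1, 1, 0, 1⟩ = 1 := by ext <;> simp <;> decide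
  exact ⟨⟨_, _, hsq, hsq⟩, rfl⟩

theorem isUnit_one_add_j_add_k : IsUnit (⟨1, 0, 1, 1⟩ : ℍ[ZMod 2]) := by
  have hsq : (⟨1, 0, 1, 1⟩ : ℍ[ZMod 2]) * ⟨1, 0, 1, 1⟩ = 1 := by ext <;> simp <;> decide
  exact ⟨⟨_, _, hsq, hsq⟩, rfl⟩

theorem fibQuat_zmod_two_classification :
    {x : ℍ[ZMod 2] | (∃ n, x = fibQuat (ZMod 2) n) ∧ ¬ IsUnit x} =
      ({⟨0, 1, 1, 0⟩} : Set ℍ[ZMod 2]) ∧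
    {x : ℍ[ZMod 2] | (∃ n, x = fibQuat (ZMod 2) n) ∧ IsUnit x} =
      ({⟨1, 1, 0, 1⟩, ⟨1, 0, 1, 1⟩} : Set ℍ[ZMod 2]) := by
  simp only [exists_eq_fibQuat_zmod_two_iff]
  constructor <;> ext x <;> constructor
  · rintro ⟨rfl | rfl | rfl, h⟩
    exacts [rfl, absurd isUnit_one_add_i_add_k h, absurd isUnit_one_add_j_add_k h]
  · rintro rfl
    exact ⟨Or.inl rfl, not_isUnit_i_add_j⟩
  · rintro ⟨h | h, hx⟩
    exacts [absurd (h ▸ hx) not_isUnit_i_add_j, h]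
  · rintro (rfl | rfl)
    exacts [⟨Or.inr (Or.inl rfl), isUnit_one_add_i_add_k⟩, ⟨Or.inr (Or.inr rfl), isUnit_one_add_j_add_k⟩]
end

section
/- Every Fibonacci quaternion F_n is a zero divisor in H[Z_3] (equivalently, no F_n is a unit), and the set {F_n : n ∈ ℕ} of Fibonacci quaternions in H[Z_3] has exactly 8 elements. -/
open Quaternion

theorem normSq_fibQuat (R : Type*) [CommRing R] (n : ℕ) :
    normSq (fibQuat R n) =
      3 * ((Nat.fib n : R) ^ 2 + 2 * Nat.fib n * Nat.fib (n + 1) + 2 * Nat.fib (n + 1) ^ 2) := by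
  rw [normSq_def']
  simp only [fibQuat, Nat.fib_add_two, Nat.cast_add]
  ring

theorem fib_zmod_three_periodic : Function.Periodic (fun n => (Nat.fib n : ZMod 3)) 8 := by
  intro n
  have h : Nat.fib (n + 8) = Nat.fib n + 3 * (4 * Nat.fib n + 7 * Nat.fib (n + 1)) := by
    simp only [Nat.fib_add_two]
    ring
  have h3 : (3 : ZMod 3) = 0 := by decide
  simp [h, h3]

theorem fibQuat_zmod_three_periodic : Function.Periodic (fibQuat (ZMod 3)) 8 := by
  intro n
  have h (k : ℕ) : (Nat.fib (n + 8 + k) : ZMod 3) = Nat.fib (n + k) := by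
    rw [add_right_comm]
    exact fib_zmod_three_periodic (n + k)
  ext
  exacts [h 0, h 1, h 2, h 3]

theorem fibQuat_zmod_three_injOn : Set.InjOn (fibQuat (ZMod 3)) (Finset.range 8) := by
  have key : ∀ m < 8, ∀ n < 8, (Nat.fib m : ZMod 3) = Nat.fib n →
      (Nat.fib (m + 1) : ZMod 3) = Nat.fib (n + 1) → m = n := by
    decide
  intro m hm n hn h
  exact key m (by simpa using hm) n (by simpa using hn)
    (congrArg QuaternionAlgebra.re h) (congrArg QuaternionAlgebra.imI h)

theorem fibQuat_zmod_three_all_zeroDivisors :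
    (∀ n : ℕ, ¬ IsUnit (fibQuat (ZMod 3) n)) ∧
    (Set.range (fibQuat (ZMod 3))).ncard = 8 := by
  constructor
  · intro n hn
    have h3 : (3 : ZMod 3) = 0 := by decide
    have h := hn.map normSq
    rw [normSq_fibQuat, h3, zero_mul] at h
    exact not_isUnit_zero h
  · have hrange : Set.range (fibQuat (ZMod 3)) = fibQuat (ZMod 3) '' (Finset.range 8) := by
      refine (Set.image_subset_range _ _).antisymm' ?_
      rintro _ ⟨n, rfl⟩
      exact ⟨n % 8, by simp [Nat.mod_lt], fibQuat_zmod_three_periodic.map_mod_nat n⟩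
    rw [hrange, fibQuat_zmod_three_injOn.ncard_image, Set.ncard_coe_finset,
      Finset.card_range]
end

section
/- Let p, q be integers, let r be a prime, and let n ≥ 1. Then the norm of the n-th generalized Fibonacci–Lucas quaternion G^{p,q}_n in H[Z_r], given by n(G^{p,q}_n) = (g^{p,q}_n)^2 + (g^{p,q}_{n+1})^2 + (g^{p,q}_{n+2})^2 + (g^{p,q}_{n+3})^2, equals the reduction modulo r of 3·p^2·f_{2n+1} + 15·q^2·f_{2n+3} + 6·p·q·(f_{2n+1} + f_{2n+3}). -/
open Quaternion

/-- The Lucas sequence, as integers: `l_n = 2·f_{n+1} - f_n`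
(equivalently `l_0 = 2`, `l_1 = 1`, `l_{n+2} = l_{n+1} + l_n`). -/
def lucas (n : ℕ) : ℤ := 2 * (Nat.fib (n + 1) : ℤ) - (Nat.fib n : ℤ)

/-- The generalized Fibonacci–Lucas numbers `g^{p,q}_n = p·f_{n-1} + q·l_n` (for `n ≥ 1`). -/
def genFL (p q : ℤ) (n : ℕ) : ℤ := p * (Nat.fib (n - 1) : ℤ) + q * lucas n

/-- The n-th generalized Fibonacci–Lucas quaternion over a commutative ring `R`:
`G^{p,q}_n = g^{p,q}_n + g^{p,q}_{n+1}·i + g^{p,q}_{n+2}·j + g^{p,q}_{n+3}·k` in `ℍ[R]`. -/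
def genFLQuat (R : Type*) [CommRing R] (p q : ℤ) (n : ℕ) : ℍ[R] :=
  ⟨(genFL p q n : R), (genFL p q (n + 1) : R), (genFL p q (n + 2) : R), (genFL p q (n + 3) : R)⟩

theorem genFL_sum_sq (p q : ℤ) (m : ℕ) :
    genFL p q (m + 1) ^ 2 + genFL p q (m + 2) ^ 2 + genFL p q (m + 3) ^ 2 +
      genFL p q (m + 4) ^ 2 =
    3 * p ^ 2 * (Nat.fib (2 * (m + 1) + 1) : ℤ) + 15 * q ^ 2 * (Nat.fib (2 * (m + 1) + 3) : ℤ) +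
      6 * p * q * ((Nat.fib (2 * (m + 1) + 1) : ℤ) + (Nat.fib (2 * (m + 1) + 3) : ℤ)) := by
  have h2 : Nat.fib (m + 2) = Nat.fib m + Nat.fib (m + 1) := Nat.fib_add_two
  have h3 : Nat.fib (m + 3) = Nat.fib (m + 1) + Nat.fib (m + 2) := Nat.fib_add_two
  have h4 : Nat.fib (m + 4) = Nat.fib (m + 2) + Nat.fib (m + 3) := Nat.fib_add_two
  have h5 : Nat.fib (m + 5) = Nat.fib (m + 3) + Nat.fib (m + 4) := Nat.fib_add_two
  have hodd₁ : Nat.fib (2 * (m + 1) + 1) = Nat.fib (m + 2) ^ 2 + Nat.fib (m + 1) ^ 2 :=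
    Nat.fib_two_mul_add_one (m + 1)
  have hodd₂ : Nat.fib (2 * (m + 1) + 3) = Nat.fib (m + 3) ^ 2 + Nat.fib (m + 2) ^ 2 :=
    Nat.fib_two_mul_add_one (m + 2)
  simp only [genFL, lucas, Nat.add_sub_cancel, Nat.add_assoc, Nat.reduceAdd, Nat.add_succ_sub_one,
    hodd₁, hodd₂, h5, h4, h3, h2]
  push_cast
  ring

theorem genFLQuat_norm (p q : ℤ) (r : ℕ) (hr : r.Prime) (n : ℕ) (hn : 1 ≤ n) :
    (genFL p q n : ZMod r) ^ 2 + (genFL p q (n + 1) : ZMod r) ^ 2 +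
      (genFL p q (n + 2) : ZMod r) ^ 2 + (genFL p q (n + 3) : ZMod r) ^ 2 =
    ((3 * p ^ 2 * (Nat.fib (2 * n + 1) : ℤ) + 15 * q ^ 2 * (Nat.fib (2 * n + 3) : ℤ) +
        6 * p * q * ((Nat.fib (2 * n + 1) : ℤ) + (Nat.fib (2 * n + 3) : ℤ)) : ℤ) : ZMod r) := by
  obtain ⟨m, rfl⟩ := Nat.exists_eq_add_of_le' hn
  exact_mod_cast congrArg (Int.cast : ℤ → ZMod r) (genFL_sum_sq p q m)
end

section
/- Let p, q be arbitrary integers. Then for every n ≥ 1, the generalized Fibonacci–Lucas quaternion G^{p,q}_n is a zero divisor in H[Z_3] (equivalently, not a unit). -/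
open Quaternion

theorem genFL_add_two (p q : ℤ) {n : ℕ} (hn : 1 ≤ n) :
    genFL p q (n + 2) = genFL p q n + genFL p q (n + 1) := by
  obtain ⟨m, rfl⟩ := Nat.exists_eq_add_of_le' hn
  simp only [genFL, lucas, Nat.add_sub_cancel, show m + 1 + 2 - 1 = m + 2 by omega, Nat.fib_add_two,
    Nat.cast_add]
  ring

theorem normSq_genFLQuat (R : Type*) [CommRing R] (p q : ℤ) {n : ℕ} (hn : 1 ≤ n) :
    Quaternion.normSq (genFLQuat R p q n) =
      3 * ((genFL p q n : R) ^ 2 + 2 * genFL p q n * genFL p q (n + 1)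
        + 2 * (genFL p q (n + 1) : R) ^ 2) := by
  rw [Quaternion.normSq_def', genFLQuat, genFL_add_two p q (n := n + 1) (by omega),
    genFL_add_two p q hn]
  push_cast
  ring

theorem genFLQuat_zmod_three_all (p q : ℤ) (n : ℕ) (hn : 1 ≤ n) :
    ¬ IsUnit (genFLQuat (ZMod 3) p q n) := by
  intro h
  have h0 := h.map Quaternion.normSq
  rw [normSq_genFLQuat (ZMod 3) p q hn, show (3 : ZMod 3) = 0 from rfl, zero_mul] at h0
  exact not_isUnit_zero h0
end

section
/- Let p, q be integers with p ≡ 0 (mod 5). Then for every n ≥ 1, the generalized Fibonacci–Lucas quaternion G^{p,q}_n is a zero divisor in H[Z_5] (equivalently, not a unit). -/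
open Quaternion

/-- The squares of four consecutive Lucas numbers sum to a multiple of `15`. -/
theorem sum_sq_lucas (n : ℕ) :
    lucas n ^ 2 + lucas (n + 1) ^ 2 + lucas (n + 2) ^ 2 + lucas (n + 3) ^ 2 =
      15 * ((Nat.fib n : ℤ) ^ 2 + 2 * Nat.fib n * Nat.fib (n + 1) +
        2 * (Nat.fib (n + 1) : ℤ) ^ 2) := by
  have h2 : Nat.fib (n + 2) = Nat.fib n + Nat.fib (n + 1) := Nat.fib_add_two
  have h3 : Nat.fib (n + 3) = Nat.fib (n + 1) + Nat.fib (n + 2) := Nat.fib_add_two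
  have h4 : Nat.fib (n + 4) = Nat.fib (n + 2) + Nat.fib (n + 3) := Nat.fib_add_two
  simp only [lucas, add_assoc, Nat.reduceAdd, h4, h3, h2]
  push_cast
  ring

theorem genFL_cast_eq {R : Type*} [CommRing R] {p : ℤ} (hp : (p : R) = 0) (q : ℤ) (n : ℕ) :
    (genFL p q n : R) = q * lucas n := by
  simp [genFL, hp]

theorem normSq_genFLQuat_of_cast_eq_zero {R : Type*} [CommRing R] {p : ℤ} (hp : (p : R) = 0)
    (q : ℤ) (n : ℕ) :
    Quaternion.normSq (genFLQuat R p q n) =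
      15 * (q ^ 2 * (Nat.fib n ^ 2 + 2 * Nat.fib n * Nat.fib (n + 1) +
        2 * Nat.fib (n + 1) ^ 2)) := by
  have h := congrArg (Int.cast : ℤ → R) (sum_sq_lucas n)
  push_cast at h
  rw [Quaternion.normSq_def']
  simp only [genFLQuat, genFL_cast_eq hp]
  linear_combination (q : R) ^ 2 * h

theorem genFLQuat_zmod_five_p_zero (p q : ℤ) (hp : p % 5 = 0) (n : ℕ) (hn : 1 ≤ n) :
    ¬ IsUnit (genFLQuat (ZMod 5) p q n) := by
  intro h
  have hp' : (p : ZMod 5) = 0 :=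
    (ZMod.intCast_zmod_eq_zero_iff_dvd p 5).2 (Int.dvd_of_emod_eq_zero hp)
  have h0 : Quaternion.normSq (genFLQuat (ZMod 5) p q n) = 0 := by
    rw [normSq_genFLQuat_of_cast_eq_zero hp', show (15 : ZMod 5) = 0 from rfl, zero_mul]
  have hu := h.map (Quaternion.normSq (R := ZMod 5))
  rw [h0] at hu
  exact absurd hu (by decide)
end

section
/- Let p, q be integers such that (p, q) ≡ (1, 2), (3, 1), (2, 4), or (4, 3) (mod 5), and let n ≥ 1. Then the generalized Fibonacci–Lucas quaternion G^{p,q}_n is a zero divisor in H[Z_5] (equivalently, not a unit) if and only if n ≡ 1 (mod 5). -/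
open Quaternion

theorem Quaternion.isUnit_normSq_iff {R : Type*} [CommRing R] {x : ℍ[R]} :
    IsUnit (normSq x) ↔ IsUnit x := by
  refine ⟨fun h => ?_, fun h => h.map normSq⟩
  have hu : IsUnit ((normSq x : R) : ℍ[R]) := h.map (algebraMap R ℍ[R])
  have hc : Commute x (star x) := by
    rw [Commute, SemiconjBy, self_mul_star, star_mul_self]
  rw [← self_mul_star, hc.isUnit_mul_iff] at hu
  exact hu.1

theorem Nat.five_dvd_fib_iff (k : ℕ) : 5 ∣ Nat.fib k ↔ 5 ∣ k := by
  refine ⟨fun h => ?_, fun h => Nat.fib_dvd 5 k h⟩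
  by_contra hk
  have hg : Nat.gcd 5 k = 1 := (Nat.Prime.coprime_iff_not_dvd Nat.prime_five).2 hk
  have hf := Nat.fib_gcd 5 k
  rw [hg, Nat.gcd_eq_left (show Nat.fib 5 ∣ Nat.fib k from h)] at hf
  exact absurd hf (by decide)

theorem Nat.sum_four_fib_sq (n : ℕ) :
    Nat.fib n ^ 2 + Nat.fib (n + 1) ^ 2 + Nat.fib (n + 2) ^ 2 + Nat.fib (n + 3) ^ 2 =
      3 * Nat.fib (2 * n + 3) := by
  have h : Nat.fib (2 * n + 3) = Nat.fib (n + 2) ^ 2 + Nat.fib (n + 1) ^ 2 :=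
    Nat.fib_two_mul_add_one (n + 1)
  rw [h, Nat.fib_add_two (n := n + 1), Nat.fib_add_two (n := n)]
  ring

/-- When `p = 3 q` in `ZMod 5`, the number `g^{p,q}_n` reduces to `q f_n`. -/
theorem genFL_cast_zmod_five {p q : ℤ} (h : (p : ZMod 5) = 3 * q) {n : ℕ} (hn : 1 ≤ n) :
    (genFL p q n : ZMod 5) = q * (Nat.fib n : ZMod 5) := by
  obtain ⟨m, rfl⟩ := Nat.exists_eq_add_of_le' hn
  have h5 : (5 : ZMod 5) = 0 := by decide
  simp only [genFL, lucas, Nat.add_sub_cancel, Nat.fib_add_two (n := m)]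
  push_cast
  rw [h]
  linear_combination (q : ZMod 5) * (Nat.fib m : ZMod 5) * h5

theorem genFLQuat_zmod_five_cases (p q : ℤ)
    (hpq : (p % 5 = 1 ∧ q % 5 = 2) ∨ (p % 5 = 3 ∧ q % 5 = 1) ∨
           (p % 5 = 2 ∧ q % 5 = 4) ∨ (p % 5 = 4 ∧ q % 5 = 3))
    (n : ℕ) (hn : 1 ≤ n) :
    ¬ IsUnit (genFLQuat (ZMod 5) p q n) ↔ n % 5 = 1 := by
  have hp : (p : ZMod 5) = 3 * q := by
    have : ((p : ℤ) : ZMod 5) = ((3 * q : ℤ) : ZMod 5) := by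
      rw [ZMod.intCast_eq_intCast_iff_dvd_sub]
      omega
    simpa using this
  have hq : (q : ZMod 5) ≠ 0 := by
    rw [Ne, ZMod.intCast_zmod_eq_zero_iff_dvd]
    omega
  have h3 : (3 : ZMod 5) ≠ 0 := by decide
  have : Fact (Nat.Prime 5) := ⟨Nat.prime_five⟩
  have hnorm : normSq (genFLQuat (ZMod 5) p q n) =
      (q : ZMod 5) ^ 2 * (3 * (Nat.fib (2 * n + 3) : ZMod 5)) := by
    have hs := congrArg (Nat.cast (R := ZMod 5)) (Nat.sum_four_fib_sq n)
    push_cast at hs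
    rw [normSq_def', ← hs]
    simp only [genFLQuat]
    rw [genFL_cast_zmod_five hp hn, genFL_cast_zmod_five hp (by omega),
      genFL_cast_zmod_five hp (by omega), genFL_cast_zmod_five hp (by omega)]
    ring
  rw [← isUnit_normSq_iff, isUnit_iff_ne_zero, not_not, hnorm,
    mul_eq_zero_iff_left (pow_ne_zero 2 hq), mul_eq_zero_iff_left h3, ZMod.natCast_eq_zero_iff, Nat.five_dvd_fib_iff]
  omega
end
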